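/- Let D ∈ ℝ^{n×d}, let l ∈ ℕ with 2l > n, let 0 < q ≤ 1 and λ > 0. Let β* ∈ ℝ^d be l-cosparse (‖Dβ*‖_0 ≤ n − l) and y = Xβ* + w with ‖w‖₂ ≤ ε. Suppose X ∈ ℝ^{m×d} satisfies (1−δ)‖v‖₂² ≤ ‖Xv‖₂² for every (2l−n)-cosparse vector v (i.e., every v with ‖Dv‖_0 ≤ 2(n−l)), for some δ < 1. Then every l-cosparse vector β̂ ∈ ℝ^d whose objective value satisfies (1/2)‖y − Xβ̂‖₂² + λ‖Dβ̂‖_q^q ≤ (1/2)‖y − Xβ*‖₂² + λ‖Dβ*‖_q^q obeys ‖β̂ − β*‖₂ ≤ C₁·√λ + C₂·ε, with C₁ = √(2‖Dβ*‖_q^q)/√(1−δ) and C₂ = 2/√(1−δ). -/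

import Mathlib

open scoped BigOperators

noncomputable section

/-- ℓq quasi-norm to the q-th power: `‖v‖_q^q = ∑ i |v i|^q`. -/
def lqq {n : ℕ} (q : ℝ) (v : Fin n → ℝ) : ℝ := ∑ i, |v i| ^ q

/-- number of nonzero entries of a vector (the ℓ0 "norm"). -/
def l0 {n : ℕ} (v : Fin n → ℝ) : ℕ := (Finset.univ.filter (fun i => v i ≠ 0)).card

/-- Euclidean norm. -/
def l2 {n : ℕ} (v : Fin n → ℝ) : ℝ := Real.sqrt (∑ i, (v i) ^ 2)

lemma l2_eq_norm {n : ℕ} (v : Fin n → ℝ) : l2 v = ‖WithLp.toLp 2 v‖ := by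
  simp [l2, EuclideanSpace.norm_eq]

lemma l2_nonneg {n : ℕ} (v : Fin n → ℝ) : 0 ≤ l2 v := Real.sqrt_nonneg _

lemma l2_neg {n : ℕ} (v : Fin n → ℝ) : l2 (-v) = l2 v := by
  simp [l2]

lemma l2_add_le {n : ℕ} (u v : Fin n → ℝ) : l2 (u + v) ≤ l2 u + l2 v := by
  simpa only [l2_eq_norm, WithLp.toLp_add] using norm_add_le (WithLp.toLp 2 u) (WithLp.toLp 2 v)

lemma lqq_nonneg {n : ℕ} (q : ℝ) (v : Fin n → ℝ) : 0 ≤ lqq q v :=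
  Finset.sum_nonneg fun _ _ => Real.rpow_nonneg (abs_nonneg _) _

lemma l0_sub_le {n : ℕ} (u v : Fin n → ℝ) : l0 (u - v) ≤ l0 u + l0 v := by
  refine (Finset.card_le_card fun i hi => ?_).trans (Finset.card_union_le _ _)
  simp only [Finset.mem_union, Finset.mem_filter, Finset.mem_univ, true_and, Pi.sub_apply] at hi ⊢
  by_contra! h
  exact hi (by rw [h.1, h.2, sub_zero])

/-- recovery guarantee for a cosparse output of the CoIRLq algorithm. If `X`
satisfies the lower restricted isometry inequality with constant `δ < 1` over
`(2l−n)`-cosparse vectors, then every `l`-cosparse `β̂` whose unconstrained ℓq-analysis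
objective value does not exceed that of the true `l`-cosparse `β*` obeys
`‖β̂ − β*‖₂ ≤ C₁ √λ + C₂ ε` with `C₁ = √(2‖Dβ*‖_q^q)/√(1−δ)` and `C₂ = 2/√(1−δ)`. -/
theorem coirlq_recovery_guarantee
    {m n d : ℕ} (X : Matrix (Fin m) (Fin d) ℝ) (D : Matrix (Fin n) (Fin d) ℝ)
    (l : ℕ) (hl : n < 2 * l) (hln : l ≤ n)
    (q lam δ ε : ℝ) (hq0 : 0 < q) (hq1 : q ≤ 1) (hlam : 0 < lam) (hδ : δ < 1)
    (βstar : Fin d → ℝ) (w : Fin m → ℝ) (y : Fin m → ℝ)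
    (hy : y = X.mulVec βstar + w) (hw : l2 w ≤ ε)
    (hcos : l0 (D.mulVec βstar) ≤ n - l)
    (hrip : ∀ v : Fin d → ℝ, l0 (D.mulVec v) ≤ 2 * (n - l) →
      (1 - δ) * (l2 v) ^ 2 ≤ (l2 (X.mulVec v)) ^ 2)
    (bhat : Fin d → ℝ) (hbcos : l0 (D.mulVec bhat) ≤ n - l)
    (hobj : (1 / 2) * (l2 (y - X.mulVec bhat)) ^ 2 + lam * lqq q (D.mulVec bhat)
        ≤ (1 / 2) * (l2 (y - X.mulVec βstar)) ^ 2 + lam * lqq q (D.mulVec βstar)) :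
    l2 (bhat - βstar)
      ≤ Real.sqrt (2 * lqq q (D.mulVec βstar)) / Real.sqrt (1 - δ) * Real.sqrt lam
        + 2 / Real.sqrt (1 - δ) * ε := by
  have hsparse : l0 (D.mulVec (bhat - βstar)) ≤ 2 * (n - l) := by
    rw [Matrix.mulVec_sub]
    have := l0_sub_le (D.mulVec bhat) (D.mulVec βstar)
    omega
  have hlower := hrip _ hsparse
  have hnoise : y - X.mulVec βstar = w := by simp [hy]
  rw [hnoise] at hobj
  set S := lqq q (D.mulVec βstar)
  have hS : 0 ≤ S := lqq_nonneg _ _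
  have hpen : 0 ≤ lam * lqq q (D.mulVec bhat) := mul_nonneg hlam.le (lqq_nonneg _ _)
  set t := Real.sqrt (2 * S) * Real.sqrt lam
  have ht : 0 ≤ t := by positivity
  have ht2 : t ^ 2 = 2 * S * lam := by
    rw [mul_pow, Real.sq_sqrt (by positivity), Real.sq_sqrt hlam.le]
  have hw0 := l2_nonneg w
  have hresid : l2 (y - X.mulVec bhat) ≤ l2 w + t :=
    le_of_abs_le <| abs_le_of_sq_le_sq (by nlinarith [mul_nonneg hw0 ht]) (by positivity)
  have hX : l2 (X.mulVec (bhat - βstar)) ≤ t + 2 * ε := by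
    have hsplit : X.mulVec (bhat - βstar) = w + -(y - X.mulVec bhat) := by
      rw [Matrix.mulVec_sub, hy]; abel
    have := l2_add_le w (-(y - X.mulVec bhat))
    rw [← hsplit, l2_neg] at this
    linarith
  have hδ' : 0 < 1 - δ := by linarith
  have hstable : Real.sqrt (1 - δ) * l2 (bhat - βstar) ≤ l2 (X.mulVec (bhat - βstar)) := by
    refine le_of_abs_le <| abs_le_of_sq_le_sq ?_ (l2_nonneg _)
    rwa [mul_pow, Real.sq_sqrt hδ'.le]
  calc l2 (bhat - βstar) ≤ (t + 2 * ε) / Real.sqrt (1 - δ) := by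
        rw [le_div_iff₀ (Real.sqrt_pos.mpr hδ'), mul_comm]
        exact hstable.trans hX
    _ = _ := by ring
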